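/- arXiv:1907.02660 — 4 statements merged into one kernel-verified Lean document; each statement's English description precedes it below -/
import Mathlib

section
/- Let δ, K1, K2, C, M be natural numbers with 3 ≤ δ, 1 ≤ K1, K1 ≤ K2, and 1 ≤ M ≤ δ. Then the following are equivalent: (i) for every i with 1 ≤ i ≤ δ, the triangle type (M, M, i) satisfies the triangle inequality, has perimeter 2M + i < C, and, when 2M + i is odd, satisfies 2·K1 < 2M + i and 2M + i < 2·K2 + 2·min(M, i); (ii) K1 ≤ M, δ ≤ 2M, M ≤ K2, and 2M + δ < C. -/
/-- A triangle type `(i, j, k)` satisfies the triangle inequality if each entry is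
at most the sum of the other two. -/
def TriangleIneq (i j k : ℕ) : Prop := i ≤ j + k ∧ j ≤ i + k ∧ k ≤ i + j

/-- Numerical core of the lemma characterizing when the class of finite substructures of a
3-constrained metrically homogeneous graph with parameters `(δ, K1, K2, C, C')` is closed
under the disjoint-sum operation `+_M`. -/
theorem plusM_closed_triangles_iff (δ K1 K2 C M : ℕ)
    (hδ : 3 ≤ δ) (hK1 : 1 ≤ K1) (hK12 : K1 ≤ K2) (hM1 : 1 ≤ M) (hMδ : M ≤ δ) :
    (∀ i : ℕ, 1 ≤ i → i ≤ δ →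
        TriangleIneq M M i ∧ 2 * M + i < C ∧
          (Odd (2 * M + i) → 2 * K1 < 2 * M + i ∧ 2 * M + i < 2 * K2 + 2 * min M i))
      ↔ (K1 ≤ M ∧ δ ≤ 2 * M ∧ M ≤ K2 ∧ 2 * M + δ < C) := by
  constructor
  · intro h
    obtain ⟨-, -, hodd⟩ := h 1 le_rfl (by omega)
    obtain ⟨hlower, hupper⟩ := hodd ⟨M, rfl⟩
    obtain ⟨⟨-, -, hδM⟩, hper, -⟩ := h δ (by omega) le_rfl
    omega
  · rintro ⟨hKM, hδM, hMK, hC⟩ i hi hiδ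
    refine ⟨⟨by omega, by omega, by omega⟩, by omega, ?_⟩
    rintro ⟨k, hk⟩
    omega
end

section
/- Let δ, K1, K2, C be natural numbers with 3 ≤ δ and 1 ≤ K1 ≤ K2 ≤ δ. Assume that either (b) C = 2·K1 + 2·K2 + 1, 2δ + 1 ≤ C ≤ 2δ + K1, and K1 + 2·K2 ≤ 2δ − 1; or (c) C ≥ 2δ + K1 + 1, K1 + 2·K2 ≥ 2δ − 1, and 2δ ≤ 3·K2. Then the following are equivalent: (i) there exists a natural number M with 1 ≤ M ≤ δ, K1 ≤ M, δ ≤ 2M, M ≤ K2, and 2M + δ < C; (ii) if C = 2δ + 1 then δ is even. -/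
/-- Purely numerical content of the lemma stating that, for an admissible parameter
sequence with `K1` finite, a suitable parameter `M` (making the age closed under the
disjoint-sum operation `+_M`) exists if and only if, when `C = 2δ + 1`, `δ` is even. -/
theorem exists_M_iff (δ K1 K2 C : ℕ)
    (hδ : 3 ≤ δ) (hK1 : 1 ≤ K1) (hK12 : K1 ≤ K2) (hK2δ : K2 ≤ δ)
    (hcase :
      (C = 2 * K1 + 2 * K2 + 1 ∧ 2 * δ + 1 ≤ C ∧ C ≤ 2 * δ + K1 ∧ K1 + 2 * K2 ≤ 2 * δ - 1) ∨
      (2 * δ + K1 + 1 ≤ C ∧ 2 * δ - 1 ≤ K1 + 2 * K2 ∧ 2 * δ ≤ 3 * K2)) :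
    (∃ M : ℕ, 1 ≤ M ∧ M ≤ δ ∧ K1 ≤ M ∧ δ ≤ 2 * M ∧ M ≤ K2 ∧ 2 * M + δ < C)
      ↔ (C = 2 * δ + 1 → Even δ) := by
  rw [Nat.even_iff]
  constructor
  · rintro ⟨M, hM⟩ hC
    omega
  · intro h
    refine ⟨max K1 ((δ + 1) / 2), ?_⟩
    omega
end

section
/- Let X and Y be finite metric spaces, each admitting a partition of its point set into two parts such that the distance between distinct points in the same part is 2, the distance between points in different parts is 1 or 3, and each point is at distance 3 from at most one other point. Then X and Y are isometric if and only if they have the same invariant triple (k, m, n). -/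
/-- A set of points `A` such that `A` and its complement exhibit the ambient metric space as a
bipartite antipodal space of diameter 3. -/
structure IsAntipodalPart {X : Type*} [MetricSpace X] (A : Finset X) : Prop where
  dist_same : ∀ x y : X, x ≠ y → (x ∈ A ↔ y ∈ A) → dist x y = 2
  dist_cross : ∀ x y : X, ¬(x ∈ A ↔ y ∈ A) → dist x y = 1 ∨ dist x y = 3
  antipode_unique : ∀ x y z : X, dist x y = 3 → dist x z = 3 → y = z

/-- Two injective families in equinumerous finite types are matched by some equivalence. -/
theorem exists_equiv_apply_eq_of_injective {P α β : Type*} [Finite α] (e : α ≃ β)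
    {i : P → α} {j : P → β} (hi : Function.Injective i) (hj : Function.Injective j) :
    ∃ g : α ≃ β, ∀ p, g (i p) = j p := by
  classical
  have hj' : Function.Injective (e.symm ∘ j) := e.symm.injective.comp hj
  have := Fintype.ofFinite α
  let f : {x // x ∈ Set.range i} ≃ {x // x ∈ Set.range (e.symm ∘ j)} :=
    (Equiv.ofInjective i hi).symm.trans (Equiv.ofInjective _ hj')
  refine ⟨f.extendSubtype.trans e, fun p => ?_⟩
  have h := f.extendSubtype_apply_of_mem (i p) ⟨p, rfl⟩
  have hp : (Equiv.ofInjective i hi).symm ⟨i p, ⟨p, rfl⟩⟩ = p :=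
    (Equiv.ofInjective i hi).symm_apply_apply p
  simp [h, f, hp]

theorem IsometryEquiv.card_antipodal_eq {X Y : Type*} [MetricSpace X] [Fintype X]
    [MetricSpace Y] [Fintype Y] (e : X ≃ᵢ Y) :
    (Finset.univ.filter (fun p : X × X => dist p.1 p.2 = 3)).card =
      (Finset.univ.filter (fun p : Y × Y => dist p.1 p.2 = 3)).card :=
  Finset.card_equiv (e.toEquiv.prodCongr e.toEquiv) fun p => by simp [e.dist_eq]

namespace IsAntipodalPart

section

variable {X : Type*} [MetricSpace X] {A : Finset X}

theorem compl [Fintype X] [DecidableEq X] (hA : IsAntipodalPart A) : IsAntipodalPart Aᶜ where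
  dist_same x y hne h := hA.dist_same x y hne (by simpa [not_iff_not] using h)
  dist_cross x y h := hA.dist_cross x y (by simpa [not_iff_not] using h)
  antipode_unique := hA.antipode_unique

theorem mem_iff_mem_iff_dist (hA : IsAntipodalPart A) (x y : X) :
    (x ∈ A ↔ y ∈ A) ↔ dist x y = 0 ∨ dist x y = 2 := by
  constructor
  · intro h
    by_cases hxy : x = y
    · simp [hxy]
    · exact Or.inr (hA.dist_same x y hxy h)
  · intro h
    by_contra hne
    rcases hA.dist_cross x y hne with h1 | h1 <;> rw [h1] at h <;> norm_num at h

theorem not_mem_iff_mem_of_dist_eq_three (hA : IsAntipodalPart A) {x y : X}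
    (h : dist x y = 3) : ¬(x ∈ A ↔ y ∈ A) := by
  rw [hA.mem_iff_mem_iff_dist, h]
  norm_num

/-- Every antipodal pair has exactly one ordering whose first point lies in `A`. -/
theorem card_antipodal_eq_two_mul [Fintype X] [DecidableEq X] (hA : IsAntipodalPart A) :
    (Finset.univ.filter (fun p : X × X => dist p.1 p.2 = 3)).card =
      2 * (Finset.univ.filter (fun p : X × X => dist p.1 p.2 = 3 ∧ p.1 ∈ A)).card := by
  rw [← Finset.card_filter_add_card_filter_not (fun p : X × X => p.1 ∈ A), Finset.filter_filter,
    Finset.filter_filter, two_mul]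
  congr 1
  refine Finset.card_bij (fun p _ => p.swap) ?_ (fun _ _ _ _ h => Prod.swap_injective h) ?_
  · rintro ⟨x, y⟩ h
    simp only [Finset.mem_filter, Finset.mem_univ, true_and, Prod.swap] at h ⊢
    have := hA.not_mem_iff_mem_of_dist_eq_three h.1
    exact ⟨dist_comm x y ▸ h.1, by tauto⟩
  · rintro ⟨x, y⟩ h
    simp only [Finset.mem_filter, Finset.mem_univ, true_and] at h
    have := hA.not_mem_iff_mem_of_dist_eq_three h.1
    refine ⟨(y, x), ?_, rfl⟩
    simp only [Finset.mem_filter, Finset.mem_univ, true_and]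
    exact ⟨dist_comm x y ▸ h.1, by tauto⟩

end

variable {X Y : Type*} [MetricSpace X] [Fintype X] [DecidableEq X]
  [MetricSpace Y] [Fintype Y] [DecidableEq Y] {A : Finset X} {B : Finset Y}

/-- An isometry maps the parts to the parts, possibly exchanging them. -/
theorem card_eq_or_card_eq_compl (hA : IsAntipodalPart A) (hB : IsAntipodalPart B) (e : X ≃ᵢ Y) :
    (A.card = B.card ∧ Aᶜ.card = Bᶜ.card) ∨ (A.card = Bᶜ.card ∧ Aᶜ.card = B.card) := by
  have key (x y : X) : (x ∈ A ↔ y ∈ A) ↔ (e x ∈ B ↔ e y ∈ B) := by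
    rw [hA.mem_iff_mem_iff_dist, hB.mem_iff_mem_iff_dist, e.dist_eq]
  have transfer {S : Finset X} {T : Finset Y} (h : ∀ x, x ∈ S ↔ e x ∈ T) : S.card = T.card :=
    Finset.card_equiv e.toEquiv h
  by_cases h : ∀ x, x ∈ A ↔ e x ∈ B
  · exact Or.inl ⟨transfer h, transfer fun x => by simp [h x]⟩
  · obtain ⟨x₀, h₀⟩ := not_forall.mp h
    have h' (x : X) : x ∈ A ↔ e x ∉ B := by
      have := key x x₀
      tauto
    exact Or.inr ⟨transfer fun x => by simp [h' x], transfer fun x => by simp [h' x]⟩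

/-- Equal part sizes and equally many antipodal pairs give an isometry respecting the parts. -/
theorem nonempty_isometryEquiv (hA : IsAntipodalPart A) (hB : IsAntipodalPart B)
    (hcard : A.card = B.card) (hcompl : Aᶜ.card = Bᶜ.card)
    (hpairs : (Finset.univ.filter (fun p : X × X => dist p.1 p.2 = 3 ∧ p.1 ∈ A)).card =
      (Finset.univ.filter (fun p : Y × Y => dist p.1 p.2 = 3 ∧ p.1 ∈ B)).card) :
    Nonempty (X ≃ᵢ Y) := by
  let P := {p : X × X // dist p.1 p.2 = 3 ∧ p.1 ∈ A}
  let Q := {p : Y × Y // dist p.1 p.2 = 3 ∧ p.1 ∈ B}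
  let φ : P ≃ Q := Fintype.equivOfCardEq (by simpa [P, Q, Fintype.card_subtype] using hpairs)
  have hP (p : P) : p.1.2 ∉ A := by
    have := hA.not_mem_iff_mem_of_dist_eq_three p.2.1
    have := p.2.2
    tauto
  have hQ (q : Q) : q.1.2 ∉ B := by
    have := hB.not_mem_iff_mem_of_dist_eq_three q.2.1
    have := q.2.2
    tauto
  have injP₁ : Function.Injective fun p : P => (⟨p.1.1, p.2.2⟩ : {x // x ∈ A}) := by
    rintro ⟨⟨x, y⟩, h, hx⟩ ⟨⟨x', y'⟩, h', hx'⟩ heq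
    obtain rfl : x = x' := congrArg Subtype.val heq
    obtain rfl := hA.antipode_unique x y y' h h'
    rfl
  have injP₂ : Function.Injective fun p : P => (⟨p.1.2, hP p⟩ : {x // x ∉ A}) := by
    rintro ⟨⟨x, y⟩, h, hx⟩ ⟨⟨x', y'⟩, h', hx'⟩ heq
    obtain rfl : y = y' := congrArg Subtype.val heq
    obtain rfl := hA.antipode_unique y x x' (dist_comm x y ▸ h) (dist_comm x' y ▸ h')
    rfl
  have injQ₁ : Function.Injective fun q : Q => (⟨q.1.1, q.2.2⟩ : {y // y ∈ B}) := by
    rintro ⟨⟨x, y⟩, h, hx⟩ ⟨⟨x', y'⟩, h', hx'⟩ heq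
    obtain rfl : x = x' := congrArg Subtype.val heq
    obtain rfl := hB.antipode_unique x y y' h h'
    rfl
  have injQ₂ : Function.Injective fun q : Q => (⟨q.1.2, hQ q⟩ : {y // y ∉ B}) := by
    rintro ⟨⟨x, y⟩, h, hx⟩ ⟨⟨x', y'⟩, h', hx'⟩ heq
    obtain rfl : y = y' := congrArg Subtype.val heq
    obtain rfl := hB.antipode_unique y x x' (dist_comm x y ▸ h) (dist_comm x' y ▸ h')
    rfl
  obtain ⟨g₁, hg₁⟩ := exists_equiv_apply_eq_of_injective
    (Fintype.equivOfCardEq (by simpa using hcard)) injP₁ (injQ₁.comp φ.injective)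
  obtain ⟨g₂, hg₂⟩ := exists_equiv_apply_eq_of_injective
    (Fintype.equivOfCardEq (by simpa [Fintype.card_subtype_compl, Finset.card_compl] using hcompl))
    injP₂ (injQ₂.comp φ.injective)
  let e : X ≃ Y := ((Equiv.sumCompl (· ∈ A)).symm.trans (Equiv.sumCongr g₁ g₂)).trans
    (Equiv.sumCompl (· ∈ B))
  have e₁ (x : X) (hx : x ∈ A) : e x = g₁ ⟨x, hx⟩ := by
    simp [e, Equiv.sumCompl_symm_apply_of_pos hx]
  have e₂ (x : X) (hx : x ∉ A) : e x = g₂ ⟨x, hx⟩ := by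
    simp [e, Equiv.sumCompl_symm_apply_of_neg hx]
  have hmem (x : X) : e x ∈ B ↔ x ∈ A := by
    by_cases hx : x ∈ A
    · simp [e₁ x hx, hx]
    · simpa [e₂ x hx, hx] using (g₂ ⟨x, hx⟩).2
  have hφ₁ (p : P) : e p.1.1 = (φ p).1.1 := by
    rw [e₁ _ p.2.2]
    exact congrArg Subtype.val (hg₁ p)
  have hφ₂ (p : P) : e p.1.2 = (φ p).1.2 := by
    rw [e₂ _ (hP p)]
    exact congrArg Subtype.val (hg₂ p)
  have three_iff (x y : X) (hx : x ∈ A) : dist (e x) (e y) = 3 ↔ dist x y = 3 := by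
    constructor
    · intro h
      let q : Q := ⟨(e x, e y), h, (hmem x).2 hx⟩
      have hx' : (φ.symm q).1.1 = x := e.injective (by simp [hφ₁, q])
      have hy' : (φ.symm q).1.2 = y := e.injective (by simp [hφ₂, q])
      rw [← hx', ← hy']
      exact (φ.symm q).2.1
    · intro h
      let p : P := ⟨(x, y), h, hx⟩
      rw [show e x = _ from hφ₁ p, show e y = _ from hφ₂ p]
      exact (φ p).2.1
  have cross (x y : X) (hx : x ∈ A) (hy : y ∉ A) : dist (e x) (e y) = dist x y := by
    have h := three_iff x y hx
    rcases hA.dist_cross x y (by tauto) with h₁ | h₁ <;>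
      rcases hB.dist_cross (e x) (e y) (by simp [hmem, hx, hy]) with h₂ | h₂ <;>
      rw [h₁, h₂] at h ⊢ <;> norm_num at h
  refine ⟨⟨e, Isometry.of_dist_eq fun x y => ?_⟩⟩
  change dist (e x) (e y) = dist x y
  by_cases hxy : x = y
  · simp [hxy]
  by_cases hx : x ∈ A <;> by_cases hy : y ∈ A
  · rw [hA.dist_same x y hxy (by tauto),
      hB.dist_same _ _ (e.injective.ne hxy) (by simp [hmem, hx, hy])]
  · exact cross x y hx hy
  · rw [dist_comm, dist_comm x]
    exact cross y x hy hx
  · rw [hA.dist_same x y hxy (by tauto),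
      hB.dist_same _ _ (e.injective.ne hxy) (by simp [hmem, hx, hy])]

end IsAntipodalPart


/-- Two finite bipartite antipodal spaces of diameter 3 (finite metric spaces
partitioned into two parts with within-part distances 2, cross distances 1 or 3, and
each point at distance 3 from at most one other point) are isometric if and only if
they have the same invariant triple `(k, m, n)`, where `k` is the number of unordered
pairs at distance 3, `m` is the smaller part size and `n` the larger part size. -/
theorem bipartite_antipodal_isometric_iff_invariant
    (X Y : Type*) [MetricSpace X] [Fintype X] [DecidableEq X]
    [MetricSpace Y] [Fintype Y] [DecidableEq Y]
    (A : Finset X)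
    (hX1 : ∀ x y : X, x ≠ y → (x ∈ A ↔ y ∈ A) → dist x y = 2)
    (hX2 : ∀ x y : X, ¬(x ∈ A ↔ y ∈ A) → dist x y = 1 ∨ dist x y = 3)
    (hX3 : ∀ x y z : X, dist x y = 3 → dist x z = 3 → y = z)
    (B : Finset Y)
    (hY1 : ∀ x y : Y, x ≠ y → (x ∈ B ↔ y ∈ B) → dist x y = 2)
    (hY2 : ∀ x y : Y, ¬(x ∈ B ↔ y ∈ B) → dist x y = 1 ∨ dist x y = 3)
    (hY3 : ∀ x y z : Y, dist x y = 3 → dist x z = 3 → y = z) :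
    Nonempty (X ≃ᵢ Y) ↔
      ((Finset.univ.filter (fun p : X × X => dist p.1 p.2 = 3)).card / 2
          = (Finset.univ.filter (fun p : Y × Y => dist p.1 p.2 = 3)).card / 2 ∧
        min A.card Aᶜ.card = min B.card Bᶜ.card ∧
        max A.card Aᶜ.card = max B.card Bᶜ.card) := by
  have hA : IsAntipodalPart A := ⟨hX1, hX2, hX3⟩
  have hB : IsAntipodalPart B := ⟨hY1, hY2, hY3⟩
  constructor
  · rintro ⟨e⟩
    refine ⟨by rw [e.card_antipodal_eq], ?_⟩
    rcases hA.card_eq_or_card_eq_compl hB e with ⟨h₁, h₂⟩ | ⟨h₁, h₂⟩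
    · simp [h₁, h₂]
    · rw [h₁, h₂]
      exact ⟨min_comm _ _, max_comm _ _⟩
  · rintro ⟨hk, hmin, hmax⟩
    have hcases : (A.card = B.card ∧ Aᶜ.card = Bᶜ.card) ∨
        (A.card = Bᶜ.card ∧ Aᶜ.card = B.card) := by omega
    rcases hcases with ⟨h₁, h₂⟩ | ⟨h₁, h₂⟩
    · rw [hA.card_antipodal_eq_two_mul, hB.card_antipodal_eq_two_mul] at hk
      exact hA.nonempty_isometryEquiv hB h₁ h₂ (by omega)
    · rw [hA.card_antipodal_eq_two_mul, hB.compl.card_antipodal_eq_two_mul] at hk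
      exact hA.nonempty_isometryEquiv hB.compl h₁ (by rwa [compl_compl]) (by omega)
end

section
/- For all natural numbers k, m, n with k ≤ m ≤ n and n ≥ 1, there exists a finite metric space X with a partition of its point set into two parts of sizes m and n such that the distance between distinct points in the same part is 2, the distance between points in different parts is 1 or 3, each point is at distance 3 from at most one other point, and the number of unordered pairs of points at distance 3 is exactly k. -/
/-- The distance on `Fin m ⊕ Fin n` for which the two summands are the parts and the first `k`
points of one part are antipodal to the first `k` points of the other. -/
def antipodalDist (k m n : ℕ) : Fin m ⊕ Fin n → Fin m ⊕ Fin n → ℝ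
  | .inl i, .inl j => if i = j then 0 else 2
  | .inr i, .inr j => if i = j then 0 else 2
  | .inl i, .inr j => if i.val = j.val ∧ i.val < k then 3 else 1
  | .inr i, .inl j => if i.val = j.val ∧ i.val < k then 3 else 1

/-- The metric space structure given by `antipodalDist`. -/
abbrev antipodalMetricSpace (k m n : ℕ) : MetricSpace (Fin m ⊕ Fin n) where
  dist := antipodalDist k m n
  dist_self := by rintro (i | i) <;> simp [antipodalDist]
  dist_comm := by rintro (i | i) (j | j) <;> simp only [antipodalDist] <;> grind
  dist_triangle := by
    rintro (i | i) (j | j) (l | l) <;> simp only [antipodalDist] <;> split_ifs <;>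
      grind
  eq_of_dist_eq_zero := by
    rintro (i | i) (j | j) <;> simp only [antipodalDist] <;> grind

lemma antipodalDist_eq_three_unique {k m n : ℕ} {x y z : Fin m ⊕ Fin n}
    (hy : antipodalDist k m n x y = 3) (hz : antipodalDist k m n x z = 3) : y = z := by
  rcases x with i | i <;> rcases y with j | j <;> rcases z with l | l <;>
    simp only [antipodalDist] at hy hz <;> grind

lemma card_antipodalDist_eq_three {k m n : ℕ} (hm : k ≤ m) (hn : k ≤ n) :
    (Finset.univ.filter fun p : (Fin m ⊕ Fin n) × (Fin m ⊕ Fin n) =>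
      antipodalDist k m n p.1 p.2 = 3).card = 2 * k := by
  let f : Fin k ⊕ Fin k → (Fin m ⊕ Fin n) × (Fin m ⊕ Fin n) :=
    Sum.elim (fun i => (.inl (i.castLE hm), .inr (i.castLE hn)))
      (fun i => (.inr (i.castLE hn), .inl (i.castLE hm)))
  have hf : Function.Injective f := by
    rintro (i | i) (j | j) h <;> simp_all [f]
  have h_image : (Finset.univ.filter fun p : (Fin m ⊕ Fin n) × (Fin m ⊕ Fin n) =>
      antipodalDist k m n p.1 p.2 = 3) = Finset.univ.image f := by
    ext ⟨x, y⟩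
    simp only [Finset.mem_filter, Finset.mem_univ, true_and, Finset.mem_image]
    constructor
    · intro h
      rcases x with i | i <;> rcases y with j | j <;> simp only [antipodalDist] at h
      · grind
      · have hij : i.val = j.val ∧ i.val < k := by grind
        exact ⟨.inl ⟨i, hij.2⟩, by simp [f, Fin.ext_iff, hij.1]⟩
      · have hij : i.val = j.val ∧ i.val < k := by grind
        exact ⟨.inr ⟨i, hij.2⟩, by simp [f, Fin.ext_iff, hij.1]⟩
      · grind
    · rintro ⟨i | i, h⟩ <;> obtain ⟨rfl, rfl⟩ := Prod.mk.inj h <;> simp [antipodalDist]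
  rw [h_image, Finset.card_image_of_injective _ hf]
  simp [two_mul]


/-- Every triple `(k, m, n)` with `k ≤ m ≤ n` and `n ≥ 1` is realized as the invariant
of a finite bipartite antipodal space of diameter 3: a finite metric space partitioned
into parts of sizes `m` and `n`, with within-part distances 2, cross distances 1 or 3,
each point at distance 3 from at most one other point, and exactly `k` unordered pairs
at distance 3 (i.e. `2k` ordered pairs). -/
theorem bipartite_antipodal_realization (k m n : ℕ) (hkm : k ≤ m) (hmn : m ≤ n)
    (hn : 1 ≤ n) :
    ∃ (X : Type) (_ : MetricSpace X) (_ : Fintype X) (_ : DecidableEq X) (A : Finset X),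
      A.card = m ∧ Aᶜ.card = n ∧
      (∀ x y : X, x ≠ y → (x ∈ A ↔ y ∈ A) → dist x y = 2) ∧
      (∀ x y : X, ¬(x ∈ A ↔ y ∈ A) → dist x y = 1 ∨ dist x y = 3) ∧
      (∀ x y z : X, dist x y = 3 → dist x z = 3 → y = z) ∧
      (Finset.univ.filter (fun p : X × X => dist p.1 p.2 = 3)).card = 2 * k := by
  refine ⟨Fin m ⊕ Fin n, antipodalMetricSpace k m n, inferInstance, inferInstance,
    Finset.univ.map .inl, by simp, ?_, ?_, ?_, fun x y z => antipodalDist_eq_three_unique, ?_⟩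
  · simp [Finset.card_compl]
  · rintro (i | i) (j | j) hne h
    · exact if_neg fun hij => hne (congrArg _ hij)
    · simp at h
    · simp at h
    · exact if_neg fun hij => hne (congrArg _ hij)
  · rintro (i | i) (j | j) h
    · simp at h
    · exact (ite_eq_or_eq _ _ _).symm
    · exact (ite_eq_or_eq _ _ _).symm
    · simp at h
  · exact card_antipodalDist_eq_three hkm (hkm.trans hmn)
end
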